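/- Fix a multi-index α with 1 ≤ |α| ≤ m and weights w ∈ ℝᴺ satisfying the moment conditions without the zeroth moment: Σ_{j=1}^N ((x_j − xᵢ)^β/β!) w_j = δ_{αβ} for every multi-index β with 1 ≤ |β| ≤ m. Then the centered discrete operator acting on function differences is exact on polynomials: Σ_{j=1}^N (u*(x_j) − u*(xᵢ)) w_j = (∂^α u*)(xᵢ) for every polynomial u* in n variables of total degree at most m. -/

import Mathlib

open scoped BigOperators

/-- The iterated partial derivative `∂^α` of a multivariate polynomial, where `α` is a
multi-index. -/
noncomputable def pderivIter {n : ℕ} (α : Fin n → ℕ) (p : MvPolynomial (Fin n) ℝ) :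
    MvPolynomial (Fin n) ℝ :=
  (List.finRange n).foldr (fun i q => (fun r => MvPolynomial.pderiv i r)^[α i] q) p

namespace MvPolynomial

variable {σ R : Type*} [CommSemiring R]

/-- The polynomial `p(X + a)`. -/
noncomputable def taylorShift (a : σ → R) : MvPolynomial σ R →ₐ[R] MvPolynomial σ R :=
  aeval fun i => X i + C (a i)

theorem eval_taylorShift (a y : σ → R) (p : MvPolynomial σ R) :
    eval y (taylorShift a p) = eval (fun i => y i + a i) p := by
  induction p using MvPolynomial.induction_on with
  | C r => simp [taylorShift]
  | add p q hp hq => simp [hp, hq]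
  | mul_X p i hp => rw [map_mul, map_mul, hp]; simp [taylorShift]

theorem pderiv_taylorShift (a : σ → R) (i : σ) (p : MvPolynomial σ R) :
    pderiv i (taylorShift a p) = taylorShift a (pderiv i p) := by
  classical
  induction p using MvPolynomial.induction_on with
  | C r => simp [taylorShift]
  | add p q hp hq => simp [hp, hq]
  | mul_X p j hp =>
    have hX : pderiv i (taylorShift a (X j)) = taylorShift a (pderiv i (X j)) := by
      by_cases h : j = i
      · subst h; simp [taylorShift]
      · simp [taylorShift, pderiv_X_of_ne h]
    rw [map_mul, pderiv_mul, pderiv_mul, hp, hX, map_add, map_mul, map_mul]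

theorem totalDegree_X_add_C_le (i : σ) (r : R) :
    (X i + C r : MvPolynomial σ R).totalDegree ≤ 1 := by
  refine (totalDegree_add _ _).trans (max_le ?_ (by simp))
  exact (totalDegree_monomial_le _ _).trans (by simp)

theorem totalDegree_taylorShift_le (a : σ → R) (p : MvPolynomial σ R) :
    (taylorShift a p).totalDegree ≤ p.totalDegree := by
  rw [taylorShift, aeval_def, eval₂_eq]
  refine totalDegree_finsetSum_le fun s hs => ?_
  refine le_trans ?_ (le_totalDegree hs)
  refine (totalDegree_mul _ _).trans ?_
  rw [algebraMap_eq, totalDegree_C, zero_add]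
  refine (totalDegree_finsetProd _ _).trans (Finset.sum_le_sum fun i _ => ?_)
  refine (totalDegree_pow _ _).trans ?_
  simpa using Nat.mul_le_mul_left (s i) (totalDegree_X_add_C_le i (a i))

theorem coeff_pderiv_iterate (i : σ) (k : ℕ) (p : MvPolynomial σ R) (s : σ →₀ ℕ) :
    coeff s ((fun r => pderiv i r)^[k] p) =
      coeff (s + Finsupp.single i k) p * ((s i + 1).ascFactorial k : ℕ) := by
  induction k generalizing p with
  | zero => simp
  | succ k ih =>
    rw [Function.iterate_succ_apply, ih, coeff_pderiv, add_assoc, ← Finsupp.single_add,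
      Nat.ascFactorial_succ]
    simp only [Finsupp.add_apply, Finsupp.single_eq_same]
    push_cast
    ring

theorem coeff_foldr_pderiv_iterate (α : σ → ℕ) (p : MvPolynomial σ R) {l : List σ}
    (hl : l.Nodup) (s : σ →₀ ℕ) (hs : ∀ i ∈ l, s i = 0) :
    coeff s (l.foldr (fun i q => (fun r => pderiv i r)^[α i] q) p) =
      coeff (s + (l.map fun i => Finsupp.single i (α i)).sum) p *
        ((l.map fun i => (α i).factorial).prod : ℕ) := by
  classical
  induction l generalizing s with
  | nil => simp
  | cons i l ih =>
    obtain ⟨hi, hl⟩ := List.nodup_cons.mp hl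
    have hs' : ∀ j ∈ l, (s + Finsupp.single i (α i)) j = 0 := fun j hj => by
      have hji : j ≠ i := fun h => hi (h ▸ hj)
      simp [hs j (List.mem_cons_of_mem _ hj), hji]
    rw [List.foldr_cons, coeff_pderiv_iterate, ih hl _ hs', hs i List.mem_cons_self, zero_add,
      Nat.one_ascFactorial, List.map_cons, List.map_cons, List.sum_cons, List.prod_cons, add_assoc]
    push_cast
    ring

end MvPolynomial

open MvPolynomial in
theorem pderivIter_taylorShift {n : ℕ} (a : Fin n → ℝ) (α : Fin n → ℕ)
    (p : MvPolynomial (Fin n) ℝ) :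
    pderivIter α (taylorShift a p) = taylorShift a (pderivIter α p) := by
  unfold pderivIter
  induction List.finRange n with
  | nil => rfl
  | cons i l ih =>
    rw [List.foldr_cons, List.foldr_cons, ih]
    exact ((Function.Semiconj.iterate_right (f := taylorShift a)
      (fun r => (pderiv_taylorShift a i r).symm) (α i)) _).symm

open MvPolynomial in
theorem eval_zero_pderivIter {n : ℕ} (α : Fin n → ℕ) (p : MvPolynomial (Fin n) ℝ) :
    eval 0 (pderivIter α p) =
      coeff (Finsupp.equivFunOnFinite.symm α) p * ∏ i, ((α i).factorial : ℝ) := by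
  have h := coeff_foldr_pderiv_iterate α p (List.nodup_finRange n) 0 fun _ _ => rfl
  rw [← List.ofFn_eq_map, ← List.ofFn_eq_map, List.sum_ofFn, List.prod_ofFn, zero_add] at h
  rw [eval_zero, constantCoeff_eq, pderivIter, h, Nat.cast_prod]
  congr 2
  ext i
  simp [Finsupp.finsetSum_apply, Finsupp.single_apply]

/-- If the weights satisfy the moment conditions without the zeroth moment,
`Σⱼ ((xⱼ − xᵢ)^β / β!) wⱼ = δ_{αβ}` for every multi-index `β` with `1 ≤ |β| ≤ m`, then the
centered discrete operator acting on function differences reproduces `∂^α` exactly on all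
polynomials of total degree at most `m`. -/
theorem centered_operator_polynomial_exactness
    (n m N : ℕ) (hn : 1 ≤ n)
    (xi : Fin n → ℝ) (x : Fin N → Fin n → ℝ)
    (α : Fin n → ℕ) (hα1 : 1 ≤ ∑ i, α i) (hαm : ∑ i, α i ≤ m)
    (w : Fin N → ℝ)
    (hmom : ∀ β : Fin n → ℕ, 1 ≤ ∑ i, β i → ∑ i, β i ≤ m →
        ∑ j, ((∏ i, (x j i - xi i) ^ β i) / ∏ i, ((β i).factorial : ℝ)) * w j
          = if β = α then 1 else 0) :
    ∀ u : MvPolynomial (Fin n) ℝ, u.totalDegree ≤ m →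
      ∑ j, (MvPolynomial.eval (x j) u - MvPolynomial.eval xi u) * w j
        = MvPolynomial.eval xi (pderivIter α u) := by
  intro u hu
  set v := MvPolynomial.taylorShift xi u with hv
  have hev (y : Fin n → ℝ) :
      MvPolynomial.eval y u = ∑ s ∈ v.support, v.coeff s * ∏ i, (y i - xi i) ^ s i := by
    rw [← MvPolynomial.eval_eq' (fun i => y i - xi i), hv, MvPolynomial.eval_taylorShift]
    simp
  have hderiv : MvPolynomial.eval xi (pderivIter α u) =
      v.coeff (Finsupp.equivFunOnFinite.symm α) * ∏ i, ((α i).factorial : ℝ) := by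
    rw [← eval_zero_pderivIter, hv, pderivIter_taylorShift, MvPolynomial.eval_taylorShift]
    simp
  have hterm : ∀ s ∈ v.support,
      ∑ j, (∏ i, (x j i - xi i) ^ s i - ∏ i, (xi i - xi i) ^ s i) * w j =
        if s = Finsupp.equivFunOnFinite.symm α then ∏ i, ((α i).factorial : ℝ) else 0 := by
    intro s hs
    have hsm : ∑ i, s i ≤ m := by
      have h := (MvPolynomial.le_totalDegree hs).trans
        ((MvPolynomial.totalDegree_taylorShift_le xi u).trans hu)
      rwa [Finsupp.sum_fintype _ _ fun _ => rfl] at h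
    have hiff : s = Finsupp.equivFunOnFinite.symm α ↔ ⇑s = α :=
      Equiv.eq_symm_apply Finsupp.equivFunOnFinite
    simp only [hiff]
    by_cases hs0 : s = 0
    · have hα : ⇑s ≠ α := by
        rintro rfl
        simp [hs0] at hα1
      rw [if_neg hα, hs0]
      simp
    obtain ⟨k, hk⟩ := Finsupp.ne_iff.mp hs0
    have hk' : s k ≠ 0 := hk
    have hs1 : 1 ≤ ∑ i, s i :=
      (Nat.one_le_iff_ne_zero.mpr hk').trans
        (Finset.single_le_sum (fun _ _ => Nat.zero_le _) (Finset.mem_univ k))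
    have hzero : ∏ i, (xi i - xi i) ^ s i = 0 :=
      Finset.prod_eq_zero (Finset.mem_univ k) (by simp [hk'])
    have hfac : ∏ i, ((s i).factorial : ℝ) ≠ 0 :=
      Finset.prod_ne_zero_iff.mpr fun i _ => by positivity
    calc ∑ j, (∏ i, (x j i - xi i) ^ s i - ∏ i, (xi i - xi i) ^ s i) * w j
        = (∏ i, ((s i).factorial : ℝ)) *
            ∑ j, ((∏ i, (x j i - xi i) ^ s i) / ∏ i, ((s i).factorial : ℝ)) * w j := by
          rw [Finset.mul_sum]
          refine Finset.sum_congr rfl fun j _ => ?_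
          rw [hzero, sub_zero]
          field_simp
      _ = if ⇑s = α then ∏ i, ((α i).factorial : ℝ) else 0 := by
          rw [hmom s hs1 hsm]
          split_ifs with h
          · rw [h, mul_one]
          · rw [mul_zero]
  calc ∑ j, (MvPolynomial.eval (x j) u - MvPolynomial.eval xi u) * w j
      = ∑ s ∈ v.support, v.coeff s *
          ∑ j, (∏ i, (x j i - xi i) ^ s i - ∏ i, (xi i - xi i) ^ s i) * w j := by
        simp only [hev, ← Finset.sum_sub_distrib, Finset.sum_mul, Finset.mul_sum]
        rw [Finset.sum_comm]
        refine Finset.sum_congr rfl fun s _ => Finset.sum_congr rfl fun j _ => ?_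
        ring
    _ = ∑ s ∈ v.support, v.coeff s *
          if s = Finsupp.equivFunOnFinite.symm α then ∏ i, ((α i).factorial : ℝ) else 0 :=
        Finset.sum_congr rfl fun s hs => by rw [hterm s hs]
    _ = MvPolynomial.eval xi (pderivIter α u) := by
        rw [hderiv]
        simp only [mul_ite, mul_zero, Finset.sum_ite_eq']
        split_ifs with h
        · rfl
        · rw [MvPolynomial.notMem_support_iff.mp h, zero_mul]
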